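/- Let L > 0, n ≥ 1, λₙ = n²π²/L², and a ∈ L∞(0,L) with λₙ ≺ a. Suppose there exist 0 = y₀ < y₁ < … < y_{2n+1} < y_{2n+2} = L with (y_{i+1} - y_i)² · ‖a‖_{L∞(y_i, y_{i+1})} ≤ π²/4 for all 0 ≤ i ≤ 2n+1, and a is not a.e. equal to the constant π²/(4(y_{i+1}-y_i)²) on at least one interval [y_i, y_{i+1}]. Then the Neumann problem u'' + au = 0, u'(0) = u'(L) = 0 has only the trivial solution. -/

import Mathlib

open MeasureTheory Real Set intervalIntegral

lemma pl_ibp (L : ℝ) (h g g' : ℝ → ℝ) (hh : IntervalIntegrable h volume 0 L)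
    (hg : ∀ x, HasDerivAt g (g' x) x) (hg' : Continuous g') :
    ∫ x in (0:ℝ)..L, (∫ t in (0:ℝ)..x, h t) * g' x
      = (∫ t in (0:ℝ)..L, h t) * g L - ∫ x in (0:ℝ)..L, h x * g x := by
  have hd : deriv g = g' := funext fun x => (hg x).deriv
  have hcd : ContDiff ℝ 1 g := by
    rw [contDiff_one_iff_deriv]
    exact ⟨fun x => (hg x).differentiableAt, hd ▸ hg'⟩
  have h1 := hh.absolutelyContinuousOnInterval_intervalIntegral (c := 0) (by simp)
  have h2 : AbsolutelyContinuousOnInterval g 0 L := hcd.contDiffOn.absolutelyContinuousOnInterval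
  have h3 := h1.integral_mul_deriv_eq_deriv_mul h2
  rw [hd] at h3
  rw [h3]
  simp only [integral_same, zero_mul, sub_zero]
  congr 1
  apply intervalIntegral.integral_congr_ae
  filter_upwards [hh.ae_hasDerivAt_integral] with x hx hx2
  rw [(hx (uIoc_subset_uIcc hx2) 0 (by simp)).deriv]

lemma pl_wirt (W W' : ℝ → ℝ) (hW : ∀ x, HasDerivAt W (W' x) x) (hc : Continuous W')
    (h0 : W 0 = 0) :
    0 ≤ ∫ x in (0:ℝ)..(π/2), (W' x ^ 2 - W x ^ 2) ∧
    ((∫ x in (0:ℝ)..(π/2), (W' x ^ 2 - W x ^ 2)) = 0 →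
      ∃ C, ∀ x ∈ Ioo (0:ℝ) (π/2), W x = C * sin x) := by
  have hWc : Continuous W := continuous_iff_continuousAt.2 fun x => (hW x).continuousAt
  set φ : ℝ → ℝ := fun x => W' x ^ 2 - W x ^ 2 with hφ
  have hφc : Continuous φ := by fun_prop
  set g : ℝ → ℝ := fun x => cos x / sin x * W x ^ 2 with hg
  have hsin : ∀ x ∈ Ioc (0:ℝ) (π/2), 0 < sin x := fun x hx =>
    sin_pos_of_pos_of_lt_pi hx.1 (by linarith [hx.2, pi_pos])
  have hgd : ∀ x ∈ Ioc (0:ℝ) (π/2), HasDerivAt g (φ x - (W' x - cos x / sin x * W x) ^ 2) x := by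
    intro x hx
    have hs := (hsin x hx).ne'
    have := ((hasDerivAt_cos x).div (hasDerivAt_sin x) hs).mul ((hW x).pow 2)
    refine this.congr_deriv ?_
    simp only [hφ, Pi.div_apply, Pi.pow_apply]
    have h1 := sin_sq_add_cos_sq x
    field_simp
    have h2 : cos x ^ 2 = 1 - sin x ^ 2 := by linarith
    push_cast
    ring_nf
  have hgc : ContinuousOn g (Icc 0 (π/2)) := by
    intro x hx
    rcases hx.1.eq_or_lt with rfl | h
    · apply ContinuousAt.continuousWithinAt
      have e : g = fun x => cos x * x * (dslope W 0 x) ^ 2 / dslope sin 0 x := by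
        funext x
        by_cases hx : x = 0
        · subst hx; simp [hg]
        · rw [dslope_of_ne _ hx, dslope_of_ne _ hx]
          simp only [hg, slope, h0, sin_zero, vsub_eq_sub, sub_zero, smul_eq_mul]
          by_cases hs : sin x = 0
          · simp [hs]
          · field_simp
      rw [e]
      have c1 : ContinuousAt (dslope W 0) 0 := continuousAt_dslope_same.2 (hW 0).differentiableAt
      have c2 : ContinuousAt (dslope sin 0) 0 :=
        continuousAt_dslope_same.2 (hasDerivAt_sin 0).differentiableAt
      refine ContinuousAt.div ?_ c2 ?_
      · fun_prop
      · rw [dslope_same]; simp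
    · exact (hgd x ⟨h, hx.2⟩).continuousAt.continuousWithinAt
  have key : ∀ p q, 0 ≤ p → p ≤ q → q ≤ π/2 → g q - g p ≤ ∫ x in p..q, φ x := by
    intro p q hp hpq hq
    apply sub_le_integral_of_hasDeriv_right_of_le hpq (hgc.mono (Icc_subset_Icc hp hq))
      (fun x hx => (hgd x ⟨by linarith [hx.1], by linarith [hx.2]⟩).hasDerivWithinAt)
      (hφc.integrableOn_Icc)
    intro x hx
    nlinarith [sq_nonneg (W' x - cos x / sin x * W x)]
  have g0 : g 0 = 0 := by simp [hg]
  have g1 : g (π/2) = 0 := by simp [hg]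
  have hpi : (0:ℝ) < π/2 := by positivity
  refine ⟨by have := key 0 (π/2) le_rfl hpi.le le_rfl; linarith, ?_⟩
  intro heq
  have hge : ∀ x ∈ Icc (0:ℝ) (π/2), g x = ∫ t in (0:ℝ)..x, φ t := by
    intro x hx
    have a1 := key 0 x le_rfl hx.1 hx.2
    have a2 := key x (π/2) hx.1 hx.2 le_rfl
    have a3 := intervalIntegral.integral_add_adjacent_intervals
      (hφc.intervalIntegrable (μ := volume) 0 x) (hφc.intervalIntegrable (μ := volume) x (π/2))
    linarith
  have hd0 : ∀ x ∈ Ioo (0:ℝ) (π/2), W' x = cos x / sin x * W x := by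
    intro x hx
    have b1 := hgd x ⟨hx.1, hx.2.le⟩
    have b2 : HasDerivAt (fun x => ∫ t in (0:ℝ)..x, φ t) (φ x) x :=
      hφc.integral_hasStrictDerivAt 0 x |>.hasDerivAt
    have b3 : g =ᶠ[nhds x] (fun x => ∫ t in (0:ℝ)..x, φ t) := by
      filter_upwards [Ioo_mem_nhds hx.1 hx.2] with t ht
      exact hge t ⟨ht.1.le, ht.2.le⟩
    have b4 := (b2.congr_of_eventuallyEq b3).unique b1
    have : (W' x - cos x / sin x * W x) ^ 2 = 0 := by linarith
    have := pow_eq_zero_iff (two_ne_zero) |>.1 this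
    linarith
  set f : ℝ → ℝ := fun x => W x / sin x with hf
  have hfd : ∀ x ∈ Ioo (0:ℝ) (π/2), HasDerivAt f 0 x := by
    intro x hx
    have hs := (hsin x ⟨hx.1, hx.2.le⟩).ne'
    refine ((hW x).div (hasDerivAt_sin x) hs).congr_deriv ?_
    rw [hd0 x hx]; field_simp; ring
  have hm : π/4 ∈ Ioo (0:ℝ) (π/2) := ⟨by positivity, by linarith [pi_pos]⟩
  refine ⟨f (π/4), fun x hx => ?_⟩
  have : f x = f (π/4) := by
    refine isOpen_Ioo.is_const_of_deriv_eq_zero isPreconnected_Ioo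
      (fun x hx => (hfd x hx).differentiableAt.differentiableWithinAt)
      (fun x hx => (hfd x hx).deriv) hx hm
  rw [← this, hf]
  have hs := (hsin x ⟨hx.1, hx.2.le⟩).ne'
  field_simp

lemma pl_wirt_aff (w w' : ℝ → ℝ) (hW : ∀ x, HasDerivAt w (w' x) x) (hc : Continuous w')
    (c d : ℝ) (hcd : c ≠ d) (h0 : w c = 0) :
    0 ≤ (d - c) * (∫ x in c..d, (w' x ^ 2 - (π / (2 * (d - c))) ^ 2 * w x ^ 2)) ∧
    ((∫ x in c..d, (w' x ^ 2 - (π / (2 * (d - c))) ^ 2 * w x ^ 2)) = 0 →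
      (∀ x ∈ Ioo (min c d) (max c d), w x = 0) ∨ (∀ x ∈ Ioo (min c d) (max c d), w x ≠ 0)) := by
  have hdc : d - c ≠ 0 := sub_ne_zero.2 hcd.symm
  have hpi := pi_pos
  set K : ℝ := (d - c) * 2 / π with hK
  have hK0 : K ≠ 0 := by rw [hK]; positivity
  have hb : π / (2 * (d - c)) = K⁻¹ := by rw [hK]; field_simp
  obtain ⟨h1, h2⟩ := pl_wirt (fun s => w (K * s + c)) (fun s => w' (K * s + c) * K)
    (fun s => by
      have := (hW (K * s + c)).comp s (((hasDerivAt_id s).const_mul K).add_const c)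
      simpa using! this) (by fun_prop) (by simpa using h0)
  have e : ∫ x in (0:ℝ)..(π/2), ((w' (K * x + c) * K) ^ 2 - w (K * x + c) ^ 2)
      = K * ∫ x in c..d, (w' x ^ 2 - (π / (2 * (d - c))) ^ 2 * w x ^ 2) := by
    have := intervalIntegral.integral_comp_mul_add (a := 0) (b := π/2)
      (fun x => (w' x * K) ^ 2 - w x ^ 2) hK0 c
    rw [this]
    have e2 : K * (π/2) + c = d := by rw [hK]; field_simp; ring
    rw [e2, hb, mul_zero, zero_add, smul_eq_mul, ← intervalIntegral.integral_const_mul,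
      ← intervalIntegral.integral_const_mul]
    congr 1; funext x; field_simp
  rw [e] at h1 h2
  constructor
  · have : (d - c) = K * (π / 2) := by rw [hK]; field_simp
    have h3 := mul_nonneg h1 (by positivity : 0 ≤ π / 2)
    clear h2 e
    generalize (∫ x in c..d, (w' x ^ 2 - (π / (2 * (d - c))) ^ 2 * w x ^ 2)) = I at *
    rw [this]; linarith
  · intro h
    rw [h] at h2
    obtain ⟨C, hC⟩ := h2 (by simp)
    have hx : ∀ x ∈ Ioo (min c d) (max c d), w x = C * sin ((x - c) / K) ∧ sin ((x - c) / K) ≠ 0 := by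
      intro x hx
      have hm : (x - c) / K ∈ Ioo 0 (π/2) := by
        have : (x - c) / K = ((x - c) / (d - c)) * (π / 2) := by rw [hK]; field_simp
        rw [this]
        have h01 : 0 < (x - c) / (d - c) ∧ (x - c) / (d - c) < 1 := by
          rcases lt_or_gt_of_ne hcd with h | h
          · rw [min_eq_left h.le, max_eq_right h.le] at hx
            exact ⟨div_pos (by linarith [hx.1]) (by linarith),
              (div_lt_one (by linarith)).2 (by linarith [hx.2])⟩
          · rw [min_eq_right h.le, max_eq_left h.le] at hx
            exact ⟨div_pos_of_neg_of_neg (by linarith [hx.2]) (by linarith),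
              (div_lt_one_of_neg (by linarith)).2 (by linarith [hx.1])⟩
        constructor <;> nlinarith [h01.1, h01.2]
      have := hC _ hm
      have e3 : K * ((x - c) / K) + c = x := by field_simp; ring
      rw [e3] at this
      exact ⟨this, (sin_pos_of_pos_of_lt_pi hm.1 (by linarith [hm.2])).ne'⟩
    by_cases hC0 : C = 0
    · left; intro x hx'; rw [(hx x hx').1, hC0, zero_mul]
    · right; intro x hx'; rw [(hx x hx').1]; exact mul_ne_zero hC0 (hx x hx').2

lemma pl_wirt' (w w' : ℝ → ℝ) (hW : ∀ x, HasDerivAt w (w' x) x) (hc : Continuous w')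
    (p q : ℝ) (hpq : p < q) (h0 : w p = 0 ∨ w q = 0) :
    0 ≤ (∫ x in p..q, (w' x ^ 2 - (π / (2 * (q - p))) ^ 2 * w x ^ 2)) ∧
    ((∫ x in p..q, (w' x ^ 2 - (π / (2 * (q - p))) ^ 2 * w x ^ 2)) = 0 →
      (∀ x ∈ Ioo p q, w x = 0) ∨ (∀ x ∈ Ioo p q, w x ≠ 0)) := by
  rcases h0 with h0 | h0
  · have := pl_wirt_aff w w' hW hc p q hpq.ne h0
    rw [min_eq_left hpq.le, max_eq_right hpq.le] at this
    exact ⟨nonneg_of_mul_nonneg_right this.1 (by linarith), this.2⟩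
  · have := pl_wirt_aff w w' hW hc q p hpq.ne' h0
    rw [min_eq_right hpq.le, max_eq_left hpq.le] at this
    have e : (π / (2 * (p - q))) ^ 2 = (π / (2 * (q - p))) ^ 2 := by
      rw [show 2 * (p - q) = - (2 * (q - p)) by ring, div_neg, neg_sq]
    rw [e, intervalIntegral.integral_symm, neg_eq_zero] at this
    exact ⟨by nlinarith [this.1], this.2⟩

/-- Orthogonality relations for the cosines. -/
lemma pl_cos_orth (L : ℝ) (hL : 0 < L) (j k : ℕ) :
    (∫ x in (0:ℝ)..L, (-(j * π / L) * sin (j * π / L * x)) * (-(k * π / L) * sin (k * π / L * x)))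
      = (j * π / L) ^ 2 * ∫ x in (0:ℝ)..L, cos (j * π / L * x) * cos (k * π / L * x) := by
  have hd : ∀ (m : ℝ) (x : ℝ), HasDerivAt (fun x => cos (m * x)) (-m * sin (m * x)) x := by
    intro m x
    have := (((hasDerivAt_id x).const_mul m)).cos
    refine this.congr_deriv ?_
    simp; ring
  have hd' : ∀ (m : ℝ) (x : ℝ), HasDerivAt (fun x => sin (m * x)) (m * cos (m * x)) x := by
    intro m x
    have := (((hasDerivAt_id x).const_mul m)).sin
    refine this.congr_deriv ?_
    simp; ring
  set m := (j * π / L) with hm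
  set l := (k * π / L) with hl
  have hs : sin (m * L) = 0 := by
    rw [hm, div_mul_cancel₀ _ hL.ne']; exact sin_nat_mul_pi j
  have := integral_eq_sub_of_hasDerivAt (a := 0) (b := L)
    (f := fun x => (-m * sin (m * x)) * cos (l * x))
    (fun x _ => ((hd' m x).const_mul (-m)).mul (hd l x))
    (Continuous.intervalIntegrable (by fun_prop) _ _)
  rw [hs] at this
  simp only [mul_zero, sin_zero, zero_mul, sub_zero] at this
  rw [intervalIntegral.integral_add (Continuous.intervalIntegrable (by fun_prop) _ _)
    (Continuous.intervalIntegrable (by fun_prop) _ _)] at this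
  rw [← intervalIntegral.integral_const_mul]
  have e : ∀ x, m ^ 2 * (cos (m * x) * cos (l * x)) = - (-m * (m * cos (m * x)) * cos (l * x)) := by
    intro x; ring
  simp_rw [e]
  rw [intervalIntegral.integral_neg]
  linarith

lemma pl_cos_orth0 (L : ℝ) (hL : 0 < L) (j k : ℕ) (hjk : j ≠ k) :
    ∫ x in (0:ℝ)..L, cos (j * π / L * x) * cos (k * π / L * x) = 0 := by
  have h1 := pl_cos_orth L hL j k
  have h2 := pl_cos_orth L hL k j
  have e1 : (∫ x in (0:ℝ)..L, (-(k * π / L) * sin (k * π / L * x)) * (-(j * π / L) * sin (j * π / L * x)))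
    = (∫ x in (0:ℝ)..L, (-(j * π / L) * sin (j * π / L * x)) * (-(k * π / L) * sin (k * π / L * x))) := by
    congr 1; funext x; ring
  have e2 : (∫ x in (0:ℝ)..L, cos (k * π / L * x) * cos (j * π / L * x))
    = ∫ x in (0:ℝ)..L, cos (j * π / L * x) * cos (k * π / L * x) := by
    congr 1; funext x; ring
  rw [e1, e2, h1] at h2
  have : ((j * π / L) ^ 2 - (k * π / L) ^ 2) *
    (∫ x in (0:ℝ)..L, cos (j * π / L * x) * cos (k * π / L * x)) = 0 := by linarith
  rcases mul_eq_zero.1 this with h | h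
  · exfalso
    apply hjk
    have h3 : (j * π / L) = (k * π / L) := by
      have : (j * π / L) ^ 2 = (k * π / L) ^ 2 := by linarith
      exact (sq_eq_sq₀ (by positivity) (by positivity)).1 this
    have hpi := pi_pos.ne'
    field_simp at h3
    exact_mod_cast h3
  · exact h

lemma pl_cos_pos (L : ℝ) (hL : 0 < L) (k : ℕ) :
    0 < ∫ x in (0:ℝ)..L, cos (k * π / L * x) * cos (k * π / L * x) := by
  apply intervalIntegral.integral_pos hL (by fun_prop)
  · intro x _; exact mul_self_nonneg _
  · exact ⟨0, ⟨le_rfl, hL.le⟩, by simp⟩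

/-- cosine polynomial and its derivative -/
noncomputable def plP (L : ℝ) (n : ℕ) (c : ℕ → ℝ) (x : ℝ) : ℝ :=
  ∑ k ∈ Finset.range (n + 1), c k * cos (k * π / L * x)

noncomputable def plP' (L : ℝ) (n : ℕ) (c : ℕ → ℝ) (x : ℝ) : ℝ :=
  ∑ k ∈ Finset.range (n + 1), c k * (-(k * π / L) * sin (k * π / L * x))

lemma plP_cont' (L : ℝ) (n : ℕ) (c : ℕ → ℝ) : Continuous (plP' L n c) := by
  unfold plP'; fun_prop

lemma plP_deriv (L : ℝ) (n : ℕ) (c : ℕ → ℝ) (x : ℝ) :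
    HasDerivAt (plP L n c) (plP' L n c x) x := by
  unfold plP plP'
  apply HasDerivAt.fun_sum
  intro k _
  apply HasDerivAt.const_mul
  have := (((hasDerivAt_id x).const_mul (k * π / L))).cos
  refine this.congr_deriv ?_
  simp; ring

lemma pl_trig (L : ℝ) (hL : 0 < L) (n : ℕ) (c : ℕ → ℝ) :
    (∫ x in (0:ℝ)..L, (plP' L n c x ^ 2 - (n : ℝ) ^ 2 * π ^ 2 / L ^ 2 * plP L n c x ^ 2)) =
      ∑ k ∈ Finset.range (n + 1), c k ^ 2 * ((k * π / L) ^ 2 - (n * π / L) ^ 2) *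
        ∫ x in (0:ℝ)..L, cos (k * π / L * x) * cos (k * π / L * x) := by
  have e : ∀ x, (plP' L n c x ^ 2 - (n : ℝ) ^ 2 * π ^ 2 / L ^ 2 * plP L n c x ^ 2)
     = ∑ j ∈ Finset.range (n + 1), ∑ k ∈ Finset.range (n + 1), (c j * c k) *
      ((-(j * π / L) * sin (j * π / L * x)) * (-(k * π / L) * sin (k * π / L * x))
        - (n * π / L) ^ 2 * (cos (j * π / L * x) * cos (k * π / L * x))) := by
    intro x
    unfold plP plP'
    rw [sq, sq (Finset.sum _ _), Finset.sum_mul_sum, Finset.sum_mul_sum, Finset.mul_sum,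
      ← Finset.sum_sub_distrib]
    apply Finset.sum_congr rfl
    intro j _
    rw [Finset.mul_sum, ← Finset.sum_sub_distrib]
    apply Finset.sum_congr rfl
    intro k _
    ring
  simp_rw [e]
  rw [intervalIntegral.integral_finsetSum
    (fun j _ => Continuous.intervalIntegrable (by fun_prop) _ _)]
  apply Finset.sum_congr rfl
  intro j hj
  rw [intervalIntegral.integral_finsetSum
    (fun j _ => Continuous.intervalIntegrable (by fun_prop) _ _)]
  have f : ∀ k : ℕ, (∫ x in (0:ℝ)..L, (c j * c k) *
      ((-(j * π / L) * sin (j * π / L * x)) * (-(k * π / L) * sin (k * π / L * x))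
        - (n * π / L) ^ 2 * (cos (j * π / L * x) * cos (k * π / L * x))))
      = (c j * c k) * ((j * π / L) ^ 2 - (n * π / L) ^ 2) *
        ∫ x in (0:ℝ)..L, cos (j * π / L * x) * cos (k * π / L * x) := by
    intro k
    rw [intervalIntegral.integral_const_mul, intervalIntegral.integral_sub
      (Continuous.intervalIntegrable (by fun_prop) _ _)
      (Continuous.intervalIntegrable (by fun_prop) _ _), pl_cos_orth L hL,
      intervalIntegral.integral_const_mul]
    ring
  simp_rw [f]
  rw [Finset.sum_eq_single j]
  · ring
  · intro k _ hk
    rw [pl_cos_orth0 L hL j k hk.symm, mul_zero]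
  · intro h; exact absurd hj h

lemma pl_trig_le (L : ℝ) (hL : 0 < L) (n : ℕ) (c : ℕ → ℝ) :
    (∫ x in (0:ℝ)..L, (plP' L n c x ^ 2 - (n : ℝ) ^ 2 * π ^ 2 / L ^ 2 * plP L n c x ^ 2)) ≤ 0 ∧
    ((∫ x in (0:ℝ)..L, (plP' L n c x ^ 2 - (n : ℝ) ^ 2 * π ^ 2 / L ^ 2 * plP L n c x ^ 2)) = 0 →
      ∀ k < n, c k = 0) := by
  rw [pl_trig L hL]
  have hlt : ∀ k : ℕ, k < n → (k * π / L) ^ 2 - (n * π / L) ^ 2 < 0 := by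
    intro k hk
    have : (k * π / L) < (n * π / L) := by
      have : (k : ℝ) < n := by exact_mod_cast hk
      have := pi_pos
      gcongr
    have h0 : 0 ≤ (k * π / L) := by positivity
    nlinarith
  have hle : ∀ k ∈ Finset.range (n + 1), c k ^ 2 * ((k * π / L) ^ 2 - (n * π / L) ^ 2) *
        (∫ x in (0:ℝ)..L, cos (k * π / L * x) * cos (k * π / L * x)) ≤ 0 := by
    intro k hk
    have h1 := (pl_cos_pos L hL k).le
    have h2 : (k * π / L) ^ 2 - (n * π / L) ^ 2 ≤ 0 := by
      rcases (Nat.lt_succ_iff.1 (Finset.mem_range.1 hk)).eq_or_lt with rfl | h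
      · simp
      · exact (hlt k h).le
    exact mul_nonpos_of_nonpos_of_nonneg (mul_nonpos_of_nonneg_of_nonpos (sq_nonneg _) h2) h1
  refine ⟨Finset.sum_nonpos hle, fun h k hk => ?_⟩
  have := (Finset.sum_eq_zero_iff_of_nonpos hle).1 h k (Finset.mem_range.2 (by omega))
  have h1 := (pl_cos_pos L hL k).ne'
  have h2 := (hlt k hk).ne
  simpa [h1, h2] using this

lemma pl_step (L : ℝ) (a u v : ℝ → ℝ) (C δ : ℝ) (hδ0 : 0 < δ) (hC : 0 ≤ C)
    (hδ : C * δ * δ ≤ 1 / 2)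
    (hb : ∀ᵐ x, x ∈ Ioo 0 L → |a x| ≤ C)
    (hu : ContinuousOn u (Icc 0 L))
    (hui : ∀ p ∈ Icc 0 L, ∀ q ∈ Icc 0 L, u q - u p = ∫ t in p..q, v t)
    (hvi : ∀ p ∈ Icc 0 L, ∀ q ∈ Icc 0 L, v q - v p = - ∫ t in p..q, a t * u t)
    (p q : ℝ) (hp : p ∈ Icc 0 L) (hq : q ∈ Icc 0 L) (hpq : |q - p| ≤ δ)
    (hup : u p = 0) (hvp : v p = 0) : u q = 0 ∧ v q = 0 := by
  have hsub : uIcc p q ⊆ Icc 0 L := by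
    intro x hx
    rw [mem_uIcc] at hx
    rcases hx with h | h
    · exact ⟨hp.1.trans h.1, h.2.trans hq.2⟩
    · exact ⟨hq.1.trans h.1, h.2.trans hp.2⟩
  obtain ⟨z, hz, hmax⟩ := isCompact_uIcc.exists_isMaxOn (nonempty_uIcc (a := p) (b := q))
    (hu.mono hsub).norm
  set M := |u z| with hM
  have hM0 : 0 ≤ M := abs_nonneg _
  have hdist : ∀ t ∈ uIcc p q, |t - p| ≤ δ := fun t ht =>
    (abs_sub_left_of_mem_uIcc ht).trans hpq
  have hv : ∀ t ∈ uIcc p q, |v t| ≤ C * M * δ := by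
    intro t ht
    have h1 := hvi p hp t (hsub ht)
    have h2 : ‖∫ s in p..t, a s * u s‖ ≤ C * M * |t - p| := by
      apply intervalIntegral.norm_integral_le_of_norm_le_const_ae
      filter_upwards [hb, (Measure.ae_ne volume L)] with s hs hsL hst
      have hs1 : s ∈ uIcc p q := uIcc_subset_uIcc_left ht (uIoc_subset_uIcc hst)
      have hs2 := hsub hs1
      have hs3 : 0 < s := by
        rw [mem_uIoc] at hst
        rcases hst with h | h
        · exact lt_of_le_of_lt hp.1 h.1
        · exact lt_of_le_of_lt (hsub ht).1 h.1
      have hs4 := hs ⟨hs3, lt_of_le_of_ne hs2.2 hsL⟩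
      rw [norm_mul]
      exact mul_le_mul hs4 (hmax hs1) (norm_nonneg _) hC
    have h3 : v t = - ∫ s in p..t, a s * u s := by linarith
    rw [h3, abs_neg]
    refine h2.trans ?_
    have := hdist t ht
    gcongr
  have huz : M ≤ C * M * δ * δ := by
    have h1 := hui p hp z (hsub hz)
    have h2 : ‖∫ s in p..z, v s‖ ≤ C * M * δ * |z - p| := by
      apply intervalIntegral.norm_integral_le_of_norm_le_const
      intro s hs
      exact hv s (uIcc_subset_uIcc_left hz (uIoc_subset_uIcc hs))
    have h3 : u z = ∫ s in p..z, v s := by linarith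
    rw [hM, h3]
    refine h2.trans ?_
    have := hdist z hz
    gcongr
    rw [← h3]
  have hM1 : M = 0 := by nlinarith
  constructor
  · have := hmax (right_mem_uIcc (a := p) (b := q))
    have h : |u q| ≤ M := this
    rw [hM1] at h
    exact abs_nonpos_iff.1 h
  · have := hv q right_mem_uIcc
    rw [hM1] at this
    simpa using this

lemma pl_unique (L : ℝ) (a u v : ℝ → ℝ) (C : ℝ)
    (hb : ∀ᵐ x, x ∈ Ioo 0 L → |a x| ≤ C)
    (hu : ContinuousOn u (Icc 0 L))
    (hui : ∀ p ∈ Icc 0 L, ∀ q ∈ Icc 0 L, u q - u p = ∫ t in p..q, v t)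
    (hvi : ∀ p ∈ Icc 0 L, ∀ q ∈ Icc 0 L, v q - v p = - ∫ t in p..q, a t * u t)
    (p : ℝ) (hp : p ∈ Icc 0 L)
    (hup : u p = 0) (hvp : v p = 0) : ∀ q ∈ Icc 0 L, u q = 0 := by
  intro q hq
  set D := |C| + 1
  have hD : 0 < D := by positivity
  have hb' : ∀ᵐ x, x ∈ Ioo 0 L → |a x| ≤ D := by
    filter_upwards [hb] with x hx hx2
    linarith [hx hx2, le_abs_self C]
  obtain ⟨δ, hδ0, hδ⟩ : ∃ δ : ℝ, 0 < δ ∧ D * δ * δ ≤ 1 / 2 := by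
    refine ⟨1 / (2 * D), by positivity, ?_⟩
    have : 1 ≤ D := by simp [D]
    field_simp
    nlinarith
  obtain ⟨N, hN⟩ := exists_nat_gt (|q - p| / δ)
  have hN0 : 0 < (N:ℝ) := lt_of_le_of_lt (by positivity) hN
  have hmem : ∀ k : ℕ, k ≤ N → p + (q - p) * (k / N) ∈ Icc 0 L := by
    intro k hk
    have h1 : (k:ℝ) / N ≤ 1 := (div_le_one hN0).2 (by exact_mod_cast hk)
    have h0 : 0 ≤ (k:ℝ) / N := by positivity
    constructor <;> nlinarith [hp.1, hp.2, hq.1, hq.2]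
  have : ∀ k : ℕ, k ≤ N → u (p + (q - p) * (k / N)) = 0 ∧ v (p + (q - p) * (k / N)) = 0 := by
    intro k
    induction k with
    | zero => intro _; simpa using ⟨hup, hvp⟩
    | succ k ih =>
      intro hk
      obtain ⟨i1, i2⟩ := ih (by omega)
      refine pl_step L a u v D δ hδ0 hD.le hδ hb' hu hui hvi _ _ (hmem k (by omega)) (hmem _ hk)
        ?_ i1 i2
      have : p + (q - p) * ((k + 1 : ℕ) / N) - (p + (q - p) * (k / N)) = (q - p) / N := by
        push_cast; field_simp; ring
      rw [this, abs_div, abs_of_pos hN0, div_le_iff₀ hN0]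
      rw [div_lt_iff₀ hδ0] at hN
      linarith
  have h := (this N le_rfl).1
  rw [div_self hN0.ne'] at h
  simpa using h

lemma pl_reg (L : ℝ) (hL : 0 < L) (a u v : ℝ → ℝ)
    (hmeas : AEStronglyMeasurable a (volume.restrict (Ioo 0 L)))
    (C : ℝ) (hb : ∀ᵐ x ∂(volume.restrict (Ioo 0 L)), |a x| ≤ C)
    (hu : ∀ x ∈ Icc (0:ℝ) L, u x = u 0 + ∫ t in (0:ℝ)..x, v t)
    (hv : ∀ x ∈ Icc (0:ℝ) L, v x = - ∫ t in (0:ℝ)..x, a t * u t) :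
    IntervalIntegrable a volume 0 L ∧ IntervalIntegrable (fun t => a t * u t) volume 0 L ∧
    ContinuousOn v (Icc 0 L) := by
  have ha : IntervalIntegrable a volume 0 L := by
    rw [intervalIntegrable_iff_integrableOn_Ioo_of_le hL.le]
    exact Integrable.of_bound hmeas C hb
  have hax : ∀ x ∈ Icc 0 L, IntervalIntegrable a volume 0 x := fun x hx =>
    ha.mono_set (by rw [uIcc_of_le hx.1, uIcc_of_le hL.le]; exact Icc_subset_Icc le_rfl hx.2)
  have F1 : ∀ x ∈ Icc 0 L, IntervalIntegrable (fun t => a t * u t) volume 0 x →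
      ContinuousOn v (Icc 0 x) := by
    intro x hx hi
    have h1 := intervalIntegral.continuousOn_primitive_interval' hi (by simp : (0:ℝ) ∈ uIcc 0 x)
    rw [uIcc_of_le hx.1] at h1
    exact h1.neg.congr fun t ht => hv t ⟨ht.1, ht.2.trans hx.2⟩
  have F2 : ∀ x ∈ Icc 0 L, IntervalIntegrable v volume 0 x → ContinuousOn u (Icc 0 x) := by
    intro x hx hi
    have h1 := intervalIntegral.continuousOn_primitive_interval' hi (by simp : (0:ℝ) ∈ uIcc 0 x)
    rw [uIcc_of_le hx.1] at h1
    exact (h1.const_add (u 0)).congr fun t ht => hu t ⟨ht.1, ht.2.trans hx.2⟩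
  have F3 : ∀ x ∈ Icc 0 L, ContinuousOn u (Icc 0 x) →
      IntervalIntegrable (fun t => a t * u t) volume 0 x := by
    intro x hx hi
    refine (hax x hx).mul_continuousOn ?_
    rwa [uIcc_of_le hx.1]
  suffices h : IntervalIntegrable (fun t => a t * u t) volume 0 L from
    ⟨ha, h, F1 L ⟨hL.le, le_rfl⟩ h⟩
  by_contra hcon
  set S : Set ℝ := {x | x ∈ Icc 0 L ∧ IntervalIntegrable (fun t => a t * u t) volume 0 x} with hS
  have hS0 : (0:ℝ) ∈ S := ⟨⟨le_rfl, hL.le⟩, by simp⟩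
  have hSb : BddAbove S := ⟨L, fun x hx => hx.1.2⟩
  set s := sSup S with hs
  have hs0 : 0 ≤ s := le_csSup hSb hS0
  have hsL : s ≤ L := csSup_le ⟨0, hS0⟩ fun x hx => hx.1.2
  have hSlt : ∀ x, 0 ≤ x → x < s → x ∈ S := by
    intro x hx0 hx
    obtain ⟨z, hz, hxz⟩ := exists_lt_of_lt_csSup ⟨0, hS0⟩ hx
    refine ⟨⟨hx0, hx.le.trans hsL⟩, hz.2.mono_set ?_⟩
    rw [uIcc_of_le hx0, uIcc_of_le hz.1.1]
    exact Icc_subset_Icc le_rfl hxz.le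
  have hv0 : ∀ x ∈ Ioc s L, v x = 0 := by
    intro x hx
    rw [hv x ⟨hs0.trans hx.1.le, hx.2⟩, intervalIntegral.integral_undef, neg_zero]
    intro h
    exact absurd (le_csSup hSb ⟨⟨hs0.trans hx.1.le, hx.2⟩, h⟩) (not_le.2 hx.1)
  have hSu : ∀ x ∈ S, ContinuousOn u (Icc 0 x) := by
    intro x hx
    apply F2 x hx.1
    apply ContinuousOn.intervalIntegrable
    rw [uIcc_of_le hx.1.1]
    exact F1 x hx.1 hx.2
  set D := |C| + 1
  have hD : 0 < D := by positivity
  have hb' : ∀ᵐ x, x ∈ Ioo 0 L → |a x| ≤ D := by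
    filter_upwards [(ae_restrict_iff' measurableSet_Ioo).1 hb] with x hx hx2
    linarith [hx hx2, le_abs_self C]
  -- bound on v from bound on u
  have hvb : ∀ x ∈ S, ∀ M, (∀ t ∈ Icc 0 x, |u t| ≤ M) → ∀ t ∈ Icc 0 x, |v t| ≤ D * M * L := by
    intro x hx M hM t ht
    have hM0 : 0 ≤ M := (abs_nonneg _).trans (hM t ht)
    rw [hv t ⟨ht.1, ht.2.trans hx.1.2⟩, abs_neg]
    have h2 : ‖∫ s in (0:ℝ)..t, a s * u s‖ ≤ D * M * |t - 0| := by
      apply intervalIntegral.norm_integral_le_of_norm_le_const_ae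
      filter_upwards [hb', (Measure.ae_ne volume L)] with s hs hsL hst
      rw [uIoc_of_le ht.1] at hst
      have hs4 := hs ⟨hst.1, lt_of_le_of_ne (hst.2.trans (ht.2.trans hx.1.2)) hsL⟩
      rw [norm_mul]
      exact mul_le_mul hs4 (hM s ⟨hst.1.le, hst.2.trans ht.2⟩) (norm_nonneg _) hD.le
    refine h2.trans ?_
    rw [sub_zero, abs_of_nonneg ht.1]
    have := ht.2.trans hx.1.2
    gcongr
  have hub : ∃ M, ∀ x ∈ Ico 0 s, |u x| ≤ M := by
    rcases hs0.eq_or_lt with h0 | h0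
    · exact ⟨0, fun x hx => by rw [← h0] at hx; simp at hx⟩
    set δ := 1 / (2 * D * L) with hδ
    have hδ0 : 0 < δ := by positivity
    have hδ1 : D * L * δ = 1 / 2 := by rw [hδ]; field_simp
    set x0 := max 0 (s - δ) with hx0
    have hx00 : 0 ≤ x0 := le_max_left _ _
    have hx0s : x0 < s := max_lt h0 (by linarith)
    have hx0S := hSlt x0 hx00 hx0s
    obtain ⟨K, hK⟩ := isCompact_Icc.exists_bound_of_continuousOn (hSu x0 hx0S)
    have hK0 : 0 ≤ K := (norm_nonneg _).trans (hK 0 ⟨le_rfl, hx00⟩)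
    refine ⟨2 * K, fun x hx => ?_⟩
    have hxS := hSlt x hx.1 hx.2
    obtain ⟨z, hz, hmax⟩ := isCompact_Icc.exists_isMaxOn (nonempty_Icc.2 hx.1) (hSu x hxS).norm
    have hmax' : ∀ t ∈ Icc 0 x, |u t| ≤ |u z| := fun t ht => hmax ht
    refine (hmax' x ⟨hx.1, le_rfl⟩).trans ?_
    rcases le_total z x0 with h | h
    · have := hK z ⟨hz.1, h⟩
      rw [norm_eq_abs] at this
      linarith
    · have hvc := F1 x hxS.1 hxS.2
      have e : u z = u x0 + ∫ t in x0..z, v t := by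
        rw [hu z ⟨hz.1, hz.2.trans hxS.1.2⟩, hu x0 hx0S.1, add_assoc,
          intervalIntegral.integral_add_adjacent_intervals]
        · apply ContinuousOn.intervalIntegrable
          rw [uIcc_of_le hx00]; exact hvc.mono (Icc_subset_Icc le_rfl (h.trans hz.2))
        · apply ContinuousOn.intervalIntegrable
          rw [uIcc_of_le h]; exact hvc.mono (Icc_subset_Icc hx00 hz.2)
      have h2 : ‖∫ t in x0..z, v t‖ ≤ D * |u z| * L * |z - x0| := by
        apply intervalIntegral.norm_integral_le_of_norm_le_const
        intro t ht
        rw [uIoc_of_le h] at ht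
        exact hvb x hxS _ hmax' t ⟨hx00.trans ht.1.le, ht.2.trans hz.2⟩
      have h3 : |z - x0| ≤ δ := by
        rw [abs_of_nonneg (by linarith)]
        linarith [le_max_right 0 (s - δ), hz.2, hx.2]
      have h4 : |u z| ≤ K + ‖∫ t in x0..z, v t‖ := by
        conv_lhs => rw [e]
        refine (abs_add_le _ _).trans ?_
        have := hK x0 ⟨hx00, le_rfl⟩
        rw [norm_eq_abs] at this
        rw [norm_eq_abs]
        linarith
      have h5 : D * |u z| * L * |z - x0| ≤ D * |u z| * L * δ := by gcongr
      have h6 : D * |u z| * L * δ = |u z| / 2 := by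
        calc D * |u z| * L * δ = |u z| * (D * L * δ) := by ring
          _ = _ := by rw [hδ1]; ring
      linarith
  obtain ⟨M, hM⟩ := hub
  have hvI : IntervalIntegrable v volume 0 s := by
    rw [intervalIntegrable_iff_integrableOn_Ioo_of_le hs0]
    refine Integrable.of_bound ?_ (D * M * L) ?_
    · refine ContinuousOn.aestronglyMeasurable ?_ measurableSet_Ioo
      intro x hx
      obtain ⟨z, hxz, hzs⟩ := exists_between hx.2
      have := hSlt z (hx.1.le.trans hxz.le) hzs
      exact ((F1 z this.1 this.2).continuousAt (Icc_mem_nhds hx.1 hxz)).continuousWithinAt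
    · refine (ae_restrict_iff' measurableSet_Ioo).2 (Filter.Eventually.of_forall fun x hx => ?_)
      exact hvb x (hSlt x hx.1.le hx.2) M (fun t ht => hM t ⟨ht.1, ht.2.trans_lt hx.2⟩) x
        ⟨hx.1.le, le_rfl⟩
  have hvI2 : IntervalIntegrable v volume s L := by
    refine (IntervalIntegrable.congr (f := fun _ => (0:ℝ)) ?_ (by simp))
    intro x hx
    rw [uIoc_of_le hsL] at hx
    exact (hv0 x hx).symm
  exact hcon (F3 L ⟨hL.le, le_rfl⟩ (F2 L ⟨hL.le, le_rfl⟩ (hvI.trans hvI2)))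

lemma pl_lin (n : ℕ) (φ : ℕ → ℕ → ℝ) : ∃ c : ℕ → ℝ, (∃ k ≤ n + 1, c k ≠ 0) ∧
    ∀ j ≤ n, ∑ k ∈ Finset.range (n + 2), φ j k * c k = 0 := by
  let M : Matrix (Fin (n + 1)) (Fin (n + 2)) ℝ := fun j k => φ j k
  have hk : LinearMap.ker M.mulVecLin ≠ ⊥ := by
    apply LinearMap.ker_ne_bot_of_finrank_lt
    simp
  obtain ⟨x, hx, hx0⟩ := (Submodule.ne_bot_iff _).1 hk
  refine ⟨fun k => if h : k < n + 2 then x ⟨k, h⟩ else 0, ?_, ?_⟩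
  · obtain ⟨k, hk⟩ := Function.ne_iff.1 hx0
    refine ⟨k, by omega, ?_⟩
    simpa using hk
  · intro j hj
    have h1 : M.mulVec x = 0 := by simpa using hx
    have h2 := congrFun h1 ⟨j, by omega⟩
    rw [← Fin.sum_univ_eq_sum_range (fun k => φ j k * (if h : k < n + 2 then x ⟨k, h⟩ else 0))]
    simpa [Matrix.mulVec, dotProduct, M] using h2

lemma pl_lower (L : ℝ) (n : ℕ) (a : ℝ → ℝ)
    (hai : IntervalIntegrable a volume 0 L)
    (y : ℕ → ℝ) (hy0 : y 0 = 0) (hyL : y (2 * n + 2) = L)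
    (hmono : StrictMonoOn y (Iic (2 * n + 2)))
    (hsub : ∀ i ≤ 2 * n + 1,
        ∀ᵐ x ∂(volume.restrict (Ioo (y i) (y (i + 1)))),
          (y (i + 1) - y i) ^ 2 * |a x| ≤ π ^ 2 / 4)
    (w w' : ℝ → ℝ) (hW : ∀ x, HasDerivAt w (w' x) x) (hc : Continuous w')
    (hz : ∀ j ≤ n, w (y (2 * j + 1)) = 0) :
    (∀ i ≤ 2 * n + 1, y i < y (i + 1) ∧
      IntervalIntegrable (fun x => ((π / (2 * (y (i + 1) - y i))) ^ 2 - a x) * w x ^ 2) volume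
        (y i) (y (i + 1)) ∧
      (∀ᵐ x ∂(volume.restrict (Ioo (y i) (y (i + 1)))),
        0 ≤ ((π / (2 * (y (i + 1) - y i))) ^ 2 - a x)) ∧
      0 ≤ ∫ x in (y i)..(y (i + 1)), ((π / (2 * (y (i + 1) - y i))) ^ 2 - a x) * w x ^ 2) ∧
    (∀ i ≤ 2 * n + 1,
      0 ≤ (∫ x in (y i)..(y (i + 1)), (w' x ^ 2 - (π / (2 * (y (i + 1) - y i))) ^ 2 * w x ^ 2)) ∧
      ((∫ x in (y i)..(y (i + 1)), (w' x ^ 2 - (π / (2 * (y (i + 1) - y i))) ^ 2 * w x ^ 2)) = 0 →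
      (∀ x ∈ Ioo (y i) (y (i + 1)), w x = 0) ∨ (∀ x ∈ Ioo (y i) (y (i + 1)), w x ≠ 0))) ∧
    ∫ x in (0:ℝ)..L, (w' x ^ 2 - a x * w x ^ 2) = ∑ i ∈ Finset.range (2 * n + 2),
      ((∫ x in (y i)..(y (i + 1)), (w' x ^ 2 - (π / (2 * (y (i + 1) - y i))) ^ 2 * w x ^ 2)) +
       ∫ x in (y i)..(y (i + 1)), ((π / (2 * (y (i + 1) - y i))) ^ 2 - a x) * w x ^ 2) := by
  have hwc : Continuous w := continuous_iff_continuousAt.2 fun x => (hW x).continuousAt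
  have hlt : ∀ i ≤ 2 * n + 1, y i < y (i + 1) := fun i hi =>
    hmono (by simp; omega) (by simp; omega) (by omega)
  have hle : ∀ i ≤ 2 * n + 1, uIcc (y i) (y (i + 1)) ⊆ uIcc 0 L := by
    intro i hi
    have h1 : 0 ≤ y i := hy0 ▸ hmono.monotoneOn (by simp) (by simp; omega) (by omega)
    have h2 : y (i + 1) ≤ L := hyL ▸ hmono.monotoneOn (by simp; omega) (by simp) (by omega)
    have h3 := hlt i hi
    rw [uIcc_of_le h3.le, uIcc_of_le (by linarith)]
    exact Icc_subset_Icc h1 h2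
  have haii : ∀ i ≤ 2 * n + 1, IntervalIntegrable a volume (y i) (y (i + 1)) := fun i hi =>
    hai.mono_set (hle i hi)
  have hint : ∀ i ≤ 2 * n + 1, IntervalIntegrable
      (fun x => ((π / (2 * (y (i + 1) - y i))) ^ 2 - a x) * w x ^ 2) volume
        (y i) (y (i + 1)) := by
    intro i hi
    exact ((by simp : IntervalIntegrable (fun _ => (π / (2 * (y (i + 1) - y i))) ^ 2) volume
      (y i) (y (i + 1))).sub (haii i hi)).mul_continuousOn (by fun_prop)
  have hnn : ∀ i ≤ 2 * n + 1, (∀ᵐ x ∂(volume.restrict (Ioo (y i) (y (i + 1)))),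
        0 ≤ ((π / (2 * (y (i + 1) - y i))) ^ 2 - a x)) := by
    intro i hi
    filter_upwards [hsub i hi] with x hx
    have h3 : 0 < y (i + 1) - y i := sub_pos.2 (hlt i hi)
    have h4 := le_abs_self (a x)
    have : |a x| ≤ (π / (2 * (y (i + 1) - y i))) ^ 2 := by
      rw [div_pow, le_div_iff₀ (by positivity)]
      nlinarith
    linarith
  refine ⟨fun i hi => ⟨hlt i hi, hint i hi, hnn i hi, ?_⟩, fun i hi => ?_, ?_⟩
  · apply intervalIntegral.integral_nonneg_of_ae_restrict (hlt i hi).le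
    rw [← Measure.restrict_congr_set Ioo_ae_eq_Icc]
    filter_upwards [hnn i hi] with x hx
    exact mul_nonneg hx (sq_nonneg _)
  · apply pl_wirt' w w' hW hc _ _ (hlt i hi)
    rcases Nat.even_or_odd' i with ⟨j, rfl | rfl⟩
    · right; exact hz j (by omega)
    · left; exact hz j (by omega)
  · have hI : ∀ i < 2 * n + 2, IntervalIntegrable (fun x => w' x ^ 2 - a x * w x ^ 2) volume
        (y i) (y (i + 1)) := by
      intro i hi
      exact (Continuous.intervalIntegrable (by fun_prop) _ _).sub
        ((haii i (by omega)).mul_continuousOn (by fun_prop))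
    have := intervalIntegral.sum_integral_adjacent_intervals hI
    rw [hy0, hyL] at this
    rw [← this]
    apply Finset.sum_congr rfl
    intro i hi
    have hi' : i ≤ 2 * n + 1 := by have := Finset.mem_range.1 hi; omega
    rw [← intervalIntegral.integral_add (Continuous.intervalIntegrable (by fun_prop) _ _)
      (hint i hi')]
    congr 1; funext x; ring

lemma pl_core (L : ℝ) (hL : 0 < L) (n : ℕ) (hn : 1 ≤ n)
    (a : ℝ → ℝ)
    (hai : IntervalIntegrable a volume 0 L)
    (C : ℝ) (hb : ∀ᵐ x ∂(volume.restrict (Ioo 0 L)), |a x| ≤ C)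
    (hprec₁ : ∀ᵐ x ∂(volume.restrict (Ioo 0 L)), (n : ℝ) ^ 2 * π ^ 2 / L ^ 2 ≤ a x)
    (hprec₂ : 0 < volume (Ioo 0 L ∩ {x | (n : ℝ) ^ 2 * π ^ 2 / L ^ 2 < a x}))
    (y : ℕ → ℝ) (hy0 : y 0 = 0) (hyL : y (2 * n + 2) = L)
    (hmono : StrictMonoOn y (Iic (2 * n + 2)))
    (hsub : ∀ i ≤ 2 * n + 1,
        ∀ᵐ x ∂(volume.restrict (Ioo (y i) (y (i + 1)))),
          (y (i + 1) - y i) ^ 2 * |a x| ≤ π ^ 2 / 4)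
    (hnotconst : ∃ i ≤ 2 * n + 1,
        ¬ (∀ᵐ x ∂(volume.restrict (Ioo (y i) (y (i + 1)))),
            a x = π ^ 2 / (4 * (y (i + 1) - y i) ^ 2)))
    (U V : ℝ → ℝ) (hU : ∀ x, HasDerivAt U (V x) x) (hVc : Continuous V)
    (hV : ∀ x ∈ Icc (0:ℝ) L, V x = - ∫ t in (0:ℝ)..x, a t * U t) (hVL : V L = 0) :
    ∀ x ∈ Icc (0:ℝ) L, U x = 0 := by
  have hUc : Continuous U := continuous_iff_continuousAt.2 fun x => (hU x).continuousAt
  have hmc : ∀ g : ℝ → ℝ, Continuous g → IntervalIntegrable (fun x => a x * g x) volume 0 L :=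
    fun g hg => hai.mul_continuousOn hg.continuousOn
  -- weak formulation
  have hB : ∀ g g' : ℝ → ℝ, (∀ x, HasDerivAt g (g' x) x) → Continuous g' →
      ∫ x in (0:ℝ)..L, (V x * g' x - a x * (U x * g x)) = 0 := by
    intro g g' hg hg'
    have hgc : Continuous g := continuous_iff_continuousAt.2 fun x => (hg x).continuousAt
    have h1 := pl_ibp L (fun t => a t * U t) g g' (hmc U hUc) hg hg'
    have h2 : ∫ t in (0:ℝ)..L, a t * U t = 0 := by
      have := hV L ⟨hL.le, le_rfl⟩
      linarith
    rw [h2] at h1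
    have h3 : ∫ x in (0:ℝ)..L, V x * g' x
        = - ∫ x in (0:ℝ)..L, (∫ t in (0:ℝ)..x, a t * U t) * g' x := by
      rw [← intervalIntegral.integral_neg]
      apply intervalIntegral.integral_congr
      intro x hx
      rw [uIcc_of_le hL.le] at hx
      simp only
      rw [hV x hx]; ring
    rw [intervalIntegral.integral_sub (Continuous.intervalIntegrable (by fun_prop) _ _)
      (hmc _ (by fun_prop)), h3, h1]
    simp only [mul_assoc]
    ring
  have hQU : ∫ x in (0:ℝ)..L, (V x ^ 2 - a x * U x ^ 2) = 0 := by
    have h := hB U V hU hVc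
    simp only [pow_two]
    exact h
  -- linear algebra
  obtain ⟨c, ⟨k0, hk0, hck0⟩, hc⟩ := pl_lin n
    (fun j k => if k ≤ n then cos (k * π / L * y (2 * j + 1)) else U (y (2 * j + 1)))
  set d := c (n + 1) with hd
  set P := plP L n c with hP
  set P' := plP' L n c with hP'
  have hPd : ∀ x, HasDerivAt P (P' x) x := plP_deriv L n c
  have hP'c : Continuous P' := plP_cont' L n c
  have hPc : Continuous P := continuous_iff_continuousAt.2 fun x => (hPd x).continuousAt
  have hwz : ∀ j ≤ n, P (y (2 * j + 1)) + d * U (y (2 * j + 1)) = 0 := by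
    intro j hj
    have := hc j hj
    rw [Finset.sum_range_succ] at this
    rw [← this, hP, plP]
    congr 1
    · apply Finset.sum_congr rfl
      intro k hk
      rw [if_pos (by have := Finset.mem_range.1 hk; omega)]; ring
    · rw [if_neg (by omega), hd]; ring
  have hwd : ∀ x, HasDerivAt (fun x => P x + d * U x) (P' x + d * V x) x := fun x =>
    (hPd x).add ((hU x).const_mul d)
  obtain ⟨l1, l2, l3⟩ := pl_lower L n a hai y hy0 hyL hmono hsub _ _ hwd (by fun_prop) hwz
  have hQw : 0 ≤ ∫ x in (0:ℝ)..L, ((P' x + d * V x) ^ 2 - a x * (P x + d * U x) ^ 2) := by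
    rw [l3]
    apply Finset.sum_nonneg
    intro i hi
    have hi' : i ≤ 2 * n + 1 := by have := Finset.mem_range.1 hi; omega
    exact add_nonneg (l2 i hi').1 (l1 i hi').2.2.2
  have hsplit : ∫ x in (0:ℝ)..L, ((P' x + d * V x) ^ 2 - a x * (P x + d * U x) ^ 2)
      = (∫ x in (0:ℝ)..L, (P' x ^ 2 - (n : ℝ) ^ 2 * π ^ 2 / L ^ 2 * P x ^ 2)) -
        ∫ x in (0:ℝ)..L, (a x - (n : ℝ) ^ 2 * π ^ 2 / L ^ 2) * P x ^ 2 := by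
    have e : ∀ x, ((P' x + d * V x) ^ 2 - a x * (P x + d * U x) ^ 2)
      = ((P' x ^ 2 - (n : ℝ) ^ 2 * π ^ 2 / L ^ 2 * P x ^ 2) -
        (a x * P x ^ 2 - (n : ℝ) ^ 2 * π ^ 2 / L ^ 2 * P x ^ 2)) +
        (2 * d * (V x * P' x - a x * (U x * P x)) + d ^ 2 * (V x ^ 2 - a x * U x ^ 2)) := by
      intro x; ring
    have i1 : IntervalIntegrable (fun x => P' x ^ 2 - (n : ℝ) ^ 2 * π ^ 2 / L ^ 2 * P x ^ 2)
      volume 0 L := Continuous.intervalIntegrable (by fun_prop) _ _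
    have i2 : IntervalIntegrable (fun x => a x * P x ^ 2 - (n : ℝ) ^ 2 * π ^ 2 / L ^ 2 * P x ^ 2)
      volume 0 L := (hmc _ (by fun_prop)).sub (Continuous.intervalIntegrable (by fun_prop) _ _)
    have i3 : IntervalIntegrable (fun x => 2 * d * (V x * P' x - a x * (U x * P x))) volume 0 L :=
      ((Continuous.intervalIntegrable (by fun_prop) _ _).sub (hmc _ (by fun_prop))).const_mul _
    have i4 : IntervalIntegrable (fun x => d ^ 2 * (V x ^ 2 - a x * U x ^ 2)) volume 0 L :=
      ((Continuous.intervalIntegrable (by fun_prop) _ _).sub (hmc _ (by fun_prop))).const_mul _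
    simp_rw [e]
    rw [intervalIntegral.integral_add (i1.sub i2) (i3.add i4),
      intervalIntegral.integral_sub i1 i2, intervalIntegral.integral_add i3 i4,
      intervalIntegral.integral_const_mul, intervalIntegral.integral_const_mul,
      hB P P' hPd hP'c, hQU]
    simp only [sub_mul, mul_zero, add_zero]
  have hnnP : 0 ≤ᵐ[volume.restrict (Ioc 0 L)]
      fun x => (a x - (n : ℝ) ^ 2 * π ^ 2 / L ^ 2) * P x ^ 2 := by
    rw [← Measure.restrict_congr_set Ioo_ae_eq_Ioc]
    filter_upwards [hprec₁] with x hx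
    exact mul_nonneg (sub_nonneg.2 hx) (sq_nonneg _)
  have hnnI : 0 ≤ ∫ x in (0:ℝ)..L, (a x - (n : ℝ) ^ 2 * π ^ 2 / L ^ 2) * P x ^ 2 := by
    rw [intervalIntegral.integral_of_le hL.le]
    exact integral_nonneg_of_ae hnnP
  obtain ⟨t1, t2⟩ := pl_trig_le L hL n c
  have hz1 := t2 (by linarith)
  have hz2 : ∫ x in (0:ℝ)..L, (a x - (n : ℝ) ^ 2 * π ^ 2 / L ^ 2) * P x ^ 2 = 0 := by linarith
  rw [intervalIntegral.integral_eq_zero_iff_of_le_of_nonneg_ae hL.le hnnP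
    ((hai.sub (by simp)).mul_continuousOn (by fun_prop))] at hz2
  rw [← Measure.restrict_congr_set Ioo_ae_eq_Ioc] at hz2
  have hPe : ∀ x, P x = c n * cos (n * π / L * x) := by
    intro x
    rw [hP, plP, Finset.sum_range_succ, Finset.sum_eq_zero, zero_add]
    intro k hk
    rw [hz1 k (Finset.mem_range.1 hk), zero_mul]
  have hcn : c n = 0 := by
    by_contra hcn
    have hμ : (0:ℝ) < n * π / L := by
      have : (0:ℝ) < n := by exact_mod_cast hn
      have := pi_pos
      positivity
    have hcount : {x : ℝ | cos (n * π / L * x) = 0}.Countable := by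
      apply (countable_range (fun k : ℤ => (2 * k + 1) * π / 2 / (n * π / L))).mono
      intro x hx
      obtain ⟨k, hk⟩ := cos_eq_zero_iff.1 hx
      refine ⟨k, ?_⟩
      simp only
      rw [← hk, mul_div_cancel_left₀ _ hμ.ne']
    have hne : ∀ᵐ x, cos (n * π / L * x) ≠ 0 := by
      have := hcount.measure_zero volume
      rw [ae_iff]; simpa using this
    apply hprec₂.ne'
    have : ∀ᵐ x ∂(volume.restrict (Ioo 0 L)), ¬ ((n : ℝ) ^ 2 * π ^ 2 / L ^ 2 < a x) := by
      filter_upwards [hz2, ae_restrict_of_ae hne] with x hx hx2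
      have hx' : (a x - (n : ℝ) ^ 2 * π ^ 2 / L ^ 2) * P x ^ 2 = 0 := hx
      rw [hPe] at hx'
      rcases mul_eq_zero.1 hx' with h | h
      · linarith
      · exact absurd h (pow_ne_zero 2 (mul_ne_zero hcn hx2))
    rw [ae_restrict_iff' measurableSet_Ioo, ae_iff] at this
    refine measure_mono_null ?_ this
    rintro x ⟨h1, h2⟩
    simp only [mem_ofPred_eq, Classical.not_imp, not_not]
    exact ⟨h1, h2⟩
  have hd0 : d ≠ 0 := by
    rcases Nat.lt_or_ge k0 n with h | h
    · exact absurd (hz1 k0 h) hck0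
    · rcases h.eq_or_lt with h | h
      · subst h; exact absurd hcn hck0
      · have : k0 = n + 1 := by omega
        rwa [this] at hck0
  have hUz : ∀ j ≤ n, U (y (2 * j + 1)) = 0 := by
    intro j hj
    have := hwz j hj
    rw [hPe, hcn, zero_mul, zero_add] at this
    exact (mul_eq_zero.1 this).resolve_left hd0
  obtain ⟨m1, m2, m3⟩ := pl_lower L n a hai y hy0 hyL hmono hsub U V hU hVc hUz
  rw [hQU] at m3
  obtain ⟨i, hi, hni⟩ := hnotconst
  have hsum := (Finset.sum_eq_zero_iff_of_nonneg (fun i hi => by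
    have hi' : i ≤ 2 * n + 1 := by have := Finset.mem_range.1 hi; omega
    exact add_nonneg (m2 i hi').1 (m1 i hi').2.2.2)).1 m3.symm i (Finset.mem_range.2 (by omega))
  obtain ⟨q1, q2, q3, q4⟩ := m1 i hi
  obtain ⟨r1, r2⟩ := m2 i hi
  rcases r2 (by linarith) with hzero | hnz
  · -- U vanishes on a subinterval
    have h1 : 0 ≤ y i := hy0 ▸ hmono.monotoneOn (by simp) (by simp; omega) (by omega)
    have h2 : y (i + 1) ≤ L := hyL ▸ hmono.monotoneOn (by simp; omega) (by simp) (by omega)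
    obtain ⟨p, hp1, hp2⟩ := exists_between q1
    have hpV : V p = 0 := by
      have : HasDerivAt U 0 p := by
        refine (hasDerivAt_const p (0:ℝ)).congr_of_eventuallyEq ?_
        filter_upwards [Ioo_mem_nhds hp1 hp2] with x hx using hzero x hx
      exact (hU p).unique this
    have hsubI : ∀ p ∈ Icc 0 L, IntervalIntegrable (fun t => a t * U t) volume 0 p := by
      intro p hp
      refine (hmc U hUc).mono_set ?_
      rw [uIcc_of_le hp.1, uIcc_of_le hL.le]
      exact Icc_subset_Icc le_rfl hp.2
    refine pl_unique L a U V C ((ae_restrict_iff' measurableSet_Ioo).1 hb) hUc.continuousOn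
      (fun p _ q _ => ?_) (fun p hp q hq => ?_) p ⟨by linarith, by linarith⟩
      (hzero p ⟨hp1, hp2⟩) hpV
    · exact (integral_eq_sub_of_hasDerivAt (fun x _ => hU x) (hVc.intervalIntegrable _ _)).symm
    · rw [hV p hp, hV q hq, ← intervalIntegral.integral_interval_sub_left (hsubI q hq) (hsubI p hp)]
      ring
  · exfalso
    apply hni
    have hq : ∫ x in (y i)..(y (i + 1)), ((π / (2 * (y (i + 1) - y i))) ^ 2 - a x) * U x ^ 2 = 0 := by
      linarith
    rw [intervalIntegral.integral_eq_zero_iff_of_le_of_nonneg_ae q1.le ?_ q2,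
      ← Measure.restrict_congr_set Ioo_ae_eq_Ioc] at hq
    · filter_upwards [hq, ae_restrict_mem measurableSet_Ioo] with x hx hxm
      have hx' : ((π / (2 * (y (i + 1) - y i))) ^ 2 - a x) * U x ^ 2 = 0 := hx
      have h := (mul_eq_zero.1 hx').resolve_right (pow_ne_zero 2 (hnz x hxm))
      have e : (π / (2 * (y (i + 1) - y i))) ^ 2 = π ^ 2 / (4 * (y (i + 1) - y i) ^ 2) := by
        rw [div_pow, mul_pow]; norm_num
      linarith
    · rw [← Measure.restrict_congr_set Ioo_ae_eq_Ioc]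
      filter_upwards [q3] with x hx
      exact mul_nonneg hx (sq_nonneg _)

/-- piecewise L∞ disfocality criterion at higher eigenvalues: if
a ∈ L∞(0,L), λₙ ≺ a, and there is a partition 0 = y₀ < … < y_{2n+2} = L with
(y_{i+1}-y_i)²‖a‖_{L∞(y_i,y_{i+1})} ≤ π²/4 for every i and a not a.e. equal to
π²/(4(y_{i+1}-y_i)²) on at least one subinterval, then the Neumann problem
u'' + au = 0, u'(0) = u'(L) = 0 has only the trivial solution. -/
theorem piecewise_Linfty_nonresonance (L : ℝ) (hL : 0 < L) (n : ℕ) (hn : 1 ≤ n)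
    (a : ℝ → ℝ)
    (hmeas : AEStronglyMeasurable a (volume.restrict (Ioo 0 L)))
    (hbdd : ∃ C : ℝ, ∀ᵐ x ∂(volume.restrict (Ioo 0 L)), |a x| ≤ C)
    (hprec₁ : ∀ᵐ x ∂(volume.restrict (Ioo 0 L)), (n : ℝ) ^ 2 * π ^ 2 / L ^ 2 ≤ a x)
    (hprec₂ : 0 < volume (Ioo 0 L ∩ {x | (n : ℝ) ^ 2 * π ^ 2 / L ^ 2 < a x}))
    (y : ℕ → ℝ) (hy0 : y 0 = 0) (hyL : y (2 * n + 2) = L)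
    (hmono : StrictMonoOn y (Iic (2 * n + 2)))
    (hsub : ∀ i ≤ 2 * n + 1,
        ∀ᵐ x ∂(volume.restrict (Ioo (y i) (y (i + 1)))),
          (y (i + 1) - y i) ^ 2 * |a x| ≤ π ^ 2 / 4)
    (hnotconst : ∃ i ≤ 2 * n + 1,
        ¬ (∀ᵐ x ∂(volume.restrict (Ioo (y i) (y (i + 1)))),
            a x = π ^ 2 / (4 * (y (i + 1) - y i) ^ 2))) :
    ∀ u v : ℝ → ℝ,
      (∀ x ∈ Icc (0:ℝ) L, u x = u 0 + ∫ t in (0:ℝ)..x, v t) →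
      (∀ x ∈ Icc (0:ℝ) L, v x = - ∫ t in (0:ℝ)..x, a t * u t) →
      v L = 0 →
      ∀ x ∈ Icc (0:ℝ) L, u x = 0 := by
  intro u v hu hv hvL
  obtain ⟨C, hC⟩ := hbdd
  obtain ⟨hai, hau, hvc⟩ := pl_reg L hL a u v hmeas C hC hu hv
  set V : ℝ → ℝ := fun x => v (max 0 (min L x)) with hVdef
  have hVc : Continuous V :=
    hvc.comp_continuous (by fun_prop) fun x => ⟨le_max_left _ _, max_le hL.le (min_le_left _ _)⟩
  have hVe : ∀ x ∈ Icc 0 L, V x = v x := by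
    intro x hx
    simp only [hVdef]
    rw [min_eq_right hx.2, max_eq_right hx.1]
  set U : ℝ → ℝ := fun x => u 0 + ∫ t in (0:ℝ)..x, V t with hUdef
  have hU : ∀ x, HasDerivAt U (V x) x := fun x =>
    ((hVc.integral_hasStrictDerivAt 0 x).hasDerivAt).const_add (u 0)
  have hUe : ∀ x ∈ Icc 0 L, U x = u x := by
    intro x hx
    rw [hu x hx]
    simp only [hUdef]
    congr 1
    apply intervalIntegral.integral_congr
    intro t ht
    rw [uIcc_of_le hx.1] at ht
    exact hVe t ⟨ht.1, ht.2.trans hx.2⟩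
  have hmain := pl_core L hL n hn a hai C hC hprec₁ hprec₂ y hy0 hyL hmono hsub hnotconst U V hU hVc
    (fun x hx => by
      rw [hVe x hx, hv x hx]
      congr 1
      apply intervalIntegral.integral_congr
      intro t ht
      rw [uIcc_of_le hx.1] at ht
      simp only
      rw [hUe t ⟨ht.1, ht.2.trans hx.2⟩])
    (by rw [hVe L ⟨hL.le, le_rfl⟩, hvL])
  intro x hx
  rw [← hUe x hx]
  exact hmain x hx
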